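/- Let m be a natural number and let a₁, a₂ : Fin m → ℝ be nonnegative functions such that for every index i exactly one of a₁(i), a₂(i) is positive (and the other is zero), the restriction of a₁ to {i | a₁(i) > 0} is injective, and the restriction of a₂ to {i | a₂(i) > 0} is injective. Then there exists a unique permutation σ of Fin m such that a₁ ∘ σ is antitone and a₂ ∘ σ is monotone. -/

import Mathlib

theorem existsUnique_perm_antitone_monotone (m : ℕ) (a₁ a₂ : Fin m → ℝ)
    (h₁ : ∀ i, 0 ≤ a₁ i) (h₂ : ∀ i, 0 ≤ a₂ i)
    (hxor : ∀ i, (0 < a₁ i ∧ a₂ i = 0) ∨ (0 < a₂ i ∧ a₁ i = 0))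
    (hinj₁ : Set.InjOn a₁ {i | 0 < a₁ i})
    (hinj₂ : Set.InjOn a₂ {i | 0 < a₂ i}) :
    ∃! σ : Equiv.Perm (Fin m), Antitone (a₁ ∘ ⇑σ) ∧ Monotone (a₂ ∘ ⇑σ) := by
  have hinj : Function.Injective (fun i => a₂ i - a₁ i) := by
    intro i j hij
    simp only at hij
    rcases hxor i with ⟨hi, hi'⟩ | ⟨hi, hi'⟩ <;> rcases hxor j with ⟨hj, hj'⟩ | ⟨hj, hj'⟩
    · exact hinj₁ hi hj (by linarith)
    · linarith
    · linarith
    · exact hinj₂ hi hj (by linarith)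
  refine ⟨Tuple.sort (fun i => a₂ i - a₁ i), ⟨?_, ?_⟩, ?_⟩
  · intro i j hij
    have h := Tuple.monotone_sort (fun i => a₂ i - a₁ i) hij
    simp only [Function.comp] at h ⊢
    generalize Tuple.sort (fun i => a₂ i - a₁ i) i = x at *
    generalize Tuple.sort (fun i => a₂ i - a₁ i) j = y at *
    have := h₁ x
    have := h₂ x
    rcases hxor x with ⟨_, _⟩ | ⟨_, _⟩ <;> rcases hxor y with ⟨_, _⟩ | ⟨_, _⟩ <;> linarith
  · intro i j hij
    have h := Tuple.monotone_sort (fun i => a₂ i - a₁ i) hij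
    simp only [Function.comp] at h ⊢
    generalize Tuple.sort (fun i => a₂ i - a₁ i) i = x at *
    generalize Tuple.sort (fun i => a₂ i - a₁ i) j = y at *
    rcases hxor x with ⟨_, _⟩ | ⟨_, _⟩ <;> rcases hxor y with ⟨_, _⟩ | ⟨_, _⟩ <;> linarith
  · rintro τ ⟨hτ₁, hτ₂⟩
    have hτ : Monotone ((fun i => a₂ i - a₁ i) ∘ ⇑τ) := fun i j hij =>
      sub_le_sub (hτ₂ hij) (hτ₁ hij)
    have h := Tuple.unique_monotone hτ (Tuple.monotone_sort (fun i => a₂ i - a₁ i))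
    ext1 i
    exact hinj (congrFun h i)
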